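/- arXiv:1712.07792 — 4 statements merged into one kernel-verified Lean document; each statement's English description precedes it below -/
import Mathlib

section
/- Let D > 0 and x₂⋆ > 0, let s(y) = D·(y − x₂⋆)/(x₂⋆·y·(y + 1)) for y > 0, and let y : [0, T] → ℝ_{>0} be a differentiable function satisfying y'(t) = s(y(t)) for all t ∈ [0, T]. If y(0) > x₂⋆ then y is strictly monotonically increasing on [0, T], and if 0 < y(0) < x₂⋆ then y is strictly monotonically decreasing on [0, T]. -/
/-- solutions of the zero dynamics `ẏ = s(y)`,
`s(y) = D·(y − x₂⋆)/(x₂⋆·y·(y+1))`, move away from the equilibrium `x₂⋆`: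
a positive solution on `[0, T]` starting above `x₂⋆` is strictly increasing,
and one starting in `(0, x₂⋆)` is strictly decreasing. -/
theorem buckboost_zero_dynamics_solutions_diverge
    (D x₂s : ℝ) (hD : 0 < D) (hx₂s : 0 < x₂s)
    (s : ℝ → ℝ) (hs : ∀ y : ℝ, s y = D * (y - x₂s) / (x₂s * y * (y + 1)))
    (T : ℝ) (hT : 0 ≤ T) (y : ℝ → ℝ)
    (hypos : ∀ t ∈ Set.Icc (0 : ℝ) T, 0 < y t)
    (hy : ∀ t ∈ Set.Icc (0 : ℝ) T, HasDerivAt y (s (y t)) t) :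
    (x₂s < y 0 → StrictMonoOn y (Set.Icc (0 : ℝ) T)) ∧
    (0 < y 0 → y 0 < x₂s → StrictAntiOn y (Set.Icc (0 : ℝ) T)) := by
  have hcont : ContinuousOn y (Set.Icc (0 : ℝ) T) :=
    fun t ht => (hy t ht).continuousAt.continuousWithinAt
  have hmono : MonotoneOn (fun t => (y t - x₂s) ^ 2) (Set.Icc (0 : ℝ) T) := by
    apply monotoneOn_of_deriv_nonneg (convex_Icc 0 T)
    · exact (hcont.sub continuousOn_const).pow 2
    · intro t ht
      exact (((hy t (interior_subset ht)).sub_const x₂s).pow 2).differentiableAt.differentiableWithinAt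
    · intro t ht
      have h := ((hy t (interior_subset ht)).sub_const x₂s).fun_pow 2
      have hp := hypos t (interior_subset ht)
      rw [h.deriv, hs]
      have e : ((2 : ℕ) : ℝ) * (y t - x₂s) ^ (2 - 1) *
          (D * (y t - x₂s) / (x₂s * y t * (y t + 1))) =
          2 * D * (y t - x₂s) ^ 2 / (x₂s * y t * (y t + 1)) := by
        push_cast
        ring
      rw [e]
      positivity
  have hne : y 0 ≠ x₂s → ∀ t ∈ Set.Icc (0 : ℝ) T, y t ≠ x₂s := by
    intro h0 t ht he
    have h := hmono (Set.left_mem_Icc.2 hT) ht ht.1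
    simp only [he, sub_self] at h
    have : 0 < (y 0 - x₂s) ^ 2 := by
      have := sub_ne_zero.2 h0
      positivity
    linarith
  constructor
  · intro h0
    have hgt : ∀ t ∈ Set.Icc (0 : ℝ) T, x₂s < y t := by
      intro t ht
      by_contra hle
      obtain ⟨r, hr, hre⟩ := intermediate_value_Icc' ht.1
        (hcont.mono (Set.Icc_subset_Icc_right ht.2)) ⟨not_lt.1 hle, h0.le⟩
      exact hne h0.ne' r ⟨hr.1, hr.2.trans ht.2⟩ hre
    apply strictMonoOn_of_deriv_pos (convex_Icc 0 T) hcont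
    intro t ht
    have hp := hypos t (interior_subset ht)
    have h1 := sub_pos.2 (hgt t (interior_subset ht))
    rw [(hy t (interior_subset ht)).deriv, hs]
    positivity
  · intro _ h0
    have hlt : ∀ t ∈ Set.Icc (0 : ℝ) T, y t < x₂s := by
      intro t ht
      by_contra hle
      obtain ⟨r, hr, hre⟩ := intermediate_value_Icc ht.1
        (hcont.mono (Set.Icc_subset_Icc_right ht.2)) ⟨h0.le, not_lt.1 hle⟩
      exact hne h0.ne r ⟨hr.1, hr.2.trans ht.2⟩ hre
    apply strictAntiOn_of_deriv_neg (convex_Icc 0 T) hcont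
    intro t ht
    have hp := hypos t (interior_subset ht)
    have h1 := sub_neg.2 (hlt t (interior_subset ht))
    rw [(hy t (interior_subset ht)).deriv, hs]
    exact div_neg_of_neg_of_pos (mul_neg_of_pos_of_neg hD h1) (by positivity)
end

section
/- Let D > 0 and k₁, k₂ ∈ ℝ, and let x = (x₁, x₂) : I → ℝ²_{>0} be a differentiable curve on an interval I satisfying the closed-loop target dynamics ẋ(τ) = F_d(x(τ))·∇H_d(x(τ)) for all τ ∈ I. Then the composite function τ ↦ H_d(x(τ)) is differentiable with derivative d/dτ H_d(x(τ)) = −(x₂(τ)/x₁(τ))·(∂H_d/∂x₁(x(τ)))² − (2x₁(τ)/(x₂(τ)+1)²)·(∂H_d/∂x₂(x(τ)))², which is ≤ 0 for all τ ∈ I. -/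
/-- The IDA-PBC Lyapunov function candidate. -/
noncomputable def Hd (D k₁ k₂ : ℝ) : ℝ × ℝ → ℝ := fun p =>
  -(1 / 2) * (p.2 + Real.sqrt 2 * D * Real.arctan (Real.sqrt 2 * p.1 / p.2)) -
    D * Real.arctan (p.1 / Real.sqrt (p.1 ^ 2 + p.2 ^ 2 / 2)) /
      (2 * Real.sqrt (p.1 ^ 2 + p.2 ^ 2 / 2)) +
    k₁ / 2 * (p.1 ^ 2 + p.2 ^ 2 / 2 + k₂) ^ 2

theorem differentiableAt_div_aux {f g : ℝ × ℝ → ℝ} {p : ℝ × ℝ}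
    (hf : DifferentiableAt ℝ f p) (hg : DifferentiableAt ℝ g p) (h0 : g p ≠ 0) :
    DifferentiableAt ℝ (fun q => f q / g q) p := by
  simp only [div_eq_mul_inv]
  exact hf.fun_mul (hg.fun_inv h0)

/-- along any positive solution of the closed-loop target dynamics
`ẋ = F_d(x)·∇H_d(x)`, the function `τ ↦ H_d(x(τ))` is differentiable with
derivative `−(x₂/x₁)·(∂H_d/∂x₁)² − (2x₁/(x₂+1)²)·(∂H_d/∂x₂)² ≤ 0`. -/
theorem Hd_decreases_along_target_dynamics
    (D k₁ k₂ : ℝ) (hD : 0 < D) (I : Set ℝ) (x₁ x₂ : ℝ → ℝ)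
    (hpos : ∀ τ ∈ I, 0 < x₁ τ ∧ 0 < x₂ τ)
    (hdyn : ∀ τ ∈ I,
      HasDerivAt (fun σ => (x₁ σ, x₂ σ))
        ((-x₂ τ / x₁ τ) * fderiv ℝ (Hd D k₁ k₂) (x₁ τ, x₂ τ) (1, 0) +
            (-2 * x₂ τ / (x₂ τ + 1)) * fderiv ℝ (Hd D k₁ k₂) (x₁ τ, x₂ τ) (0, 1),
          (2 * x₂ τ / (x₂ τ + 1)) * fderiv ℝ (Hd D k₁ k₂) (x₁ τ, x₂ τ) (1, 0) +
            (-2 * x₁ τ / (x₂ τ + 1) ^ 2) * fderiv ℝ (Hd D k₁ k₂) (x₁ τ, x₂ τ) (0, 1)) τ) :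
    ∀ τ ∈ I,
      HasDerivAt (fun σ => Hd D k₁ k₂ (x₁ σ, x₂ σ))
        (-(x₂ τ / x₁ τ) * (fderiv ℝ (Hd D k₁ k₂) (x₁ τ, x₂ τ) (1, 0)) ^ 2 -
          (2 * x₁ τ / (x₂ τ + 1) ^ 2) * (fderiv ℝ (Hd D k₁ k₂) (x₁ τ, x₂ τ) (0, 1)) ^ 2) τ ∧
      -(x₂ τ / x₁ τ) * (fderiv ℝ (Hd D k₁ k₂) (x₁ τ, x₂ τ) (1, 0)) ^ 2 -
          (2 * x₁ τ / (x₂ τ + 1) ^ 2) * (fderiv ℝ (Hd D k₁ k₂) (x₁ τ, x₂ τ) (0, 1)) ^ 2 ≤ 0 := by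
  intro τ hτ
  obtain ⟨h1, h2⟩ := hpos τ hτ
  have hd := hdyn τ hτ
  have hr : (0:ℝ) < (x₁ τ) ^ 2 + (x₂ τ) ^ 2 / 2 := by positivity
  have hdiff : DifferentiableAt ℝ (Hd D k₁ k₂) (x₁ τ, x₂ τ) := by
    have hs : DifferentiableAt ℝ (fun p : ℝ × ℝ => Real.sqrt (p.1 ^ 2 + p.2 ^ 2 / 2))
        (x₁ τ, x₂ τ) := by
      apply DifferentiableAt.sqrt
      · fun_prop
      · exact hr.ne'
    have hs0 : Real.sqrt ((x₁ τ) ^ 2 + (x₂ τ) ^ 2 / 2) ≠ 0 := (Real.sqrt_pos.mpr hr).ne'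
    have ha : DifferentiableAt ℝ (fun p : ℝ × ℝ => Real.arctan (Real.sqrt 2 * p.1 / p.2))
        (x₁ τ, x₂ τ) := by
      apply DifferentiableAt.arctan
      apply differentiableAt_div_aux
      · fun_prop
      · fun_prop
      · exact h2.ne'
    have hb : DifferentiableAt ℝ
        (fun p : ℝ × ℝ => Real.arctan (p.1 / Real.sqrt (p.1 ^ 2 + p.2 ^ 2 / 2)))
        (x₁ τ, x₂ τ) := by
      apply DifferentiableAt.arctan
      exact differentiableAt_div_aux (by fun_prop) hs hs0
    have hc : DifferentiableAt ℝ
        (fun p : ℝ × ℝ => D * Real.arctan (p.1 / Real.sqrt (p.1 ^ 2 + p.2 ^ 2 / 2)) /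
          (2 * Real.sqrt (p.1 ^ 2 + p.2 ^ 2 / 2)))
        (x₁ τ, x₂ τ) :=
      differentiableAt_div_aux (hb.const_mul D) (hs.const_mul 2) (mul_ne_zero two_ne_zero hs0)
    have he : DifferentiableAt ℝ
        (fun p : ℝ × ℝ => -(1 / 2) * (p.2 + Real.sqrt 2 * D *
          Real.arctan (Real.sqrt 2 * p.1 / p.2))) (x₁ τ, x₂ τ) :=
      (differentiableAt_snd.fun_add (ha.const_mul _)).const_mul _
    have hf : DifferentiableAt ℝ
        (fun p : ℝ × ℝ => k₁ / 2 * (p.1 ^ 2 + p.2 ^ 2 / 2 + k₂) ^ 2) (x₁ τ, x₂ τ) := by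
      fun_prop
    exact (he.fun_sub hc).fun_add hf
  have hlin : ∀ a b : ℝ, fderiv ℝ (Hd D k₁ k₂) (x₁ τ, x₂ τ) (a, b) =
      a * fderiv ℝ (Hd D k₁ k₂) (x₁ τ, x₂ τ) (1, 0) +
      b * fderiv ℝ (Hd D k₁ k₂) (x₁ τ, x₂ τ) (0, 1) := by
    intro a b
    have : ((a, b) : ℝ × ℝ) = a • ((1, 0) : ℝ × ℝ) + b • ((0, 1) : ℝ × ℝ) := by simp
    rw [this, map_add, map_smul, map_smul, smul_eq_mul, smul_eq_mul]
  constructor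
  · have hcomp := HasFDerivAt.comp_hasDerivAt τ hdiff.hasFDerivAt hd
    rw [hlin] at hcomp
    refine hcomp.congr_deriv ?_
    ring
  · have e1 : 0 ≤ (x₂ τ / x₁ τ) * (fderiv ℝ (Hd D k₁ k₂) (x₁ τ, x₂ τ) (1, 0)) ^ 2 := by
      positivity
    have e2 : 0 ≤ (2 * x₁ τ / (x₂ τ + 1) ^ 2) *
        (fderiv ℝ (Hd D k₁ k₂) (x₁ τ, x₂ τ) (0, 1)) ^ 2 := by
      positivity
    linarith
end

section
/- Let D > 0 and γ > 0, and let x₁, x₂, D_I : ℝ_{≥0} → ℝ and u : ℝ_{≥0} → ℝ be functions with x₂(t) ≠ 0 for all t, x₂ and D_I differentiable, satisfying ẋ₂(t) = (1−u(t))·x₁(t) − D/x₂(t) and Ḋ_I(t) = γ·x₁(t)·x₂(t)·(1−u(t)) + (1/2)·γ²·x₂(t)² − γ·D_I(t) for all t ≥ 0. Define the estimate D̂(t) = −(1/2)·γ·x₂(t)² + D_I(t) and the estimation error D̃(t) = D̂(t) − D. Then D̃ satisfies Ḋ̃(t) = −γ·D̃(t), and hence D̃(t) = e^{−γt}·D̃(0)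 for all t ≥ 0; in particular D̂(t) converges exponentially to D for any initial condition D_I(0) and any control signal u. -/
/-- the immersion and invariance (I&I) load-power estimator.
With `ẋ₂ = (1−u)x₁ − D/x₂` and `Ḋ_I = γx₁x₂(1−u) + (1/2)γ²x₂² − γD_I`, the
estimation error `D̃ = D̂ − D`, where `D̂ = −(1/2)γx₂² + D_I`, satisfies
`Ḋ̃ = −γD̃` and hence `D̃(t) = e^{−γt}·D̃(0)` for all `t ≥ 0`, for any initial
condition `D_I(0)` and any control signal `u`. -/
theorem ini_power_estimator_converges
    (D γ : ℝ) (hD : 0 < D) (hγ : 0 < γ)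
    (x₁ x₂ DI u : ℝ → ℝ)
    (hx₂ne : ∀ t : ℝ, 0 ≤ t → x₂ t ≠ 0)
    (hx₂ : ∀ t : ℝ, 0 ≤ t →
      HasDerivAt x₂ ((1 - u t) * x₁ t - D / x₂ t) t)
    (hDI : ∀ t : ℝ, 0 ≤ t →
      HasDerivAt DI (γ * x₁ t * x₂ t * (1 - u t) + (1 / 2) * γ ^ 2 * x₂ t ^ 2 - γ * DI t) t)
    (Dhat Dtil : ℝ → ℝ)
    (hDhat : ∀ t : ℝ, Dhat t = -(1 / 2) * γ * x₂ t ^ 2 + DI t)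
    (hDtil : ∀ t : ℝ, Dtil t = Dhat t - D) :
    (∀ t : ℝ, 0 ≤ t → HasDerivAt Dtil (-γ * Dtil t) t) ∧
    (∀ t : ℝ, 0 ≤ t → Dtil t = Real.exp (-γ * t) * Dtil 0) := by
  have key : ∀ t : ℝ, 0 ≤ t → HasDerivAt Dtil (-γ * Dtil t) t := by
    intro t ht
    have hfun : Dtil = fun s => -(1 / 2) * γ * x₂ s ^ 2 + DI s - D := by
      funext s
      rw [hDtil, hDhat]
    have h := ((((hx₂ t ht).pow 2).const_mul (-(1 / 2) * γ)).add (hDI t ht)).sub_const D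
    have hne := hx₂ne t ht
    rw [hfun]
    refine h.congr_deriv ?_
    field_simp
    ring
  refine ⟨key, ?_⟩
  intro t ht
  have hg : ∀ s : ℝ, 0 ≤ s → HasDerivAt (fun s => Real.exp (γ * s) * Dtil s) 0 s := by
    intro s hs
    have h1 : HasDerivAt (fun s : ℝ => Real.exp (γ * s)) (Real.exp (γ * s) * (γ * 1)) s :=
      ((hasDerivAt_id s).const_mul γ).exp
    refine (h1.mul (key s hs)).congr_deriv ?_
    ring
  have hc := constant_of_has_deriv_right_zero (a := 0) (b := t)
    (f := fun s => Real.exp (γ * s) * Dtil s)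
    (fun s hs => (hg s hs.1).continuousAt.continuousWithinAt)
    (fun s hs => (hg s hs.1).hasDerivWithinAt) t ⟨ht, le_refl t⟩
  simp only [mul_zero, Real.exp_zero, one_mul] at hc
  rw [← hc, ← mul_assoc, ← Real.exp_add]
  simp
end

section
/- Let D > 0, x₂⋆ > 0 and k_p, k_d ∈ ℝ, and consider the real 2×2 matrix J = [[k_p·(1+x₂⋆), k_d·(1+x₂⋆) − 1/(1+x₂⋆)], [1/(1+x₂⋆) − D·k_p·(1+x₂⋆)/x₂⋆, −D·(k_d·x₂⋆·(1+x₂⋆) − 1)/x₂⋆²]]. Then trace(J) = k_p·(1+x₂⋆) − k_d·D·(1/x₂⋆ + 1) + D/x₂⋆² and det(J) = k_p·D/x₂⋆² − k_d + 1/(x₂⋆+1)², and every (complex) eigenvalue of J has strictly negative real part if and only if m₂·k_p + b₂ > k_d > m₁·k_p + b₁, where m₁ = x₂⋆/D, b₁ = 1/(x₂⋆ + x₂⋆²), m₂ = D/x₂⋆², b₂ = 1/(1+x₂⋆)². -/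
open Matrix

/-- Routh-Hurwitz for real monic quadratics. -/
lemma quad_hurwitz (t d : ℝ) :
    (∀ μ : ℂ, μ ^ 2 - t * μ + d = 0 → μ.re < 0) ↔ (t < 0 ∧ 0 < d) := by
  constructor
  · intro h
    obtain ⟨s, hs⟩ := IsAlgClosed.exists_pow_nat_eq ((t : ℂ) ^ 2 - 4 * d) (n := 2) (by norm_num)
    have h1 := h ((t + s) / 2) (by linear_combination hs / 4)
    have h2 := h ((t - s) / 2) (by linear_combination hs / 4)
    have hre := congrArg Complex.re hs
    have him := congrArg Complex.im hs
    simp [pow_two] at h1 h2 hre him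
    have ht : t < 0 := by linarith
    refine ⟨ht, ?_⟩
    have h0 : s.re * s.im = 0 := by linarith
    rcases mul_eq_zero.mp h0 with h0 | h0 <;> rw [h0] at hre
    · nlinarith [mul_self_nonneg s.im, mul_pos_of_neg_of_neg ht ht]
    · nlinarith [mul_pos_of_neg_of_neg (show t + s.re < 0 by linarith)
        (show t - s.re < 0 by linarith)]
  · rintro ⟨ht, hd⟩ μ hμ
    have hre := congrArg Complex.re hμ
    have him := congrArg Complex.im hμ
    simp [pow_two] at hre him
    by_contra hcon
    have hcon : 0 ≤ μ.re := not_lt.mp hcon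
    have h0 : μ.im * (2 * μ.re - t) = 0 := by linarith
    rcases mul_eq_zero.mp h0 with h0 | h0
    · rw [h0] at hre
      nlinarith [mul_self_nonneg μ.re, mul_nonneg hcon (neg_nonneg.mpr ht.le)]
    · linarith

lemma mem_spec_iff (J : Matrix (Fin 2) (Fin 2) ℝ) (μ : ℂ) :
    μ ∈ spectrum ℂ (J.map (Complex.ofReal)) ↔
      μ ^ 2 - (J.trace : ℝ) * μ + (J.det : ℝ) = 0 := by
  rw [spectrum.mem_iff, Matrix.isUnit_iff_isUnit_det, isUnit_iff_ne_zero, not_not,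
    Matrix.det_fin_two, Matrix.det_fin_two, Matrix.trace_fin_two]
  simp [Matrix.algebraMap_matrix_apply]
  constructor <;> intro h <;> linear_combination h

/-- the Jacobian `J` of the PD-controlled buck-boost error dynamics
has the stated trace and determinant, and is Hurwitz (every complex eigenvalue
has strictly negative real part) iff `m₂·k_p + b₂ > k_d > m₁·k_p + b₁`. -/
theorem pd_jacobian_hurwitz_iff
    (D x₂s kp kd : ℝ) (hD : 0 < D) (hx₂s : 0 < x₂s)
    (J : Matrix (Fin 2) (Fin 2) ℝ)
    (hJ : J = !![kp * (1 + x₂s), kd * (1 + x₂s) - 1 / (1 + x₂s);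
                 1 / (1 + x₂s) - D * kp * (1 + x₂s) / x₂s,
                 -D * (kd * x₂s * (1 + x₂s) - 1) / x₂s ^ 2])
    (m₁ b₁ m₂ b₂ : ℝ)
    (hm₁ : m₁ = x₂s / D) (hb₁ : b₁ = 1 / (x₂s + x₂s ^ 2))
    (hm₂ : m₂ = D / x₂s ^ 2) (hb₂ : b₂ = 1 / (1 + x₂s) ^ 2) :
    J.trace = kp * (1 + x₂s) - kd * D * (1 / x₂s + 1) + D / x₂s ^ 2 ∧
    J.det = kp * D / x₂s ^ 2 - kd + 1 / (x₂s + 1) ^ 2 ∧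
    ((∀ μ ∈ spectrum ℂ (J.map (Complex.ofReal)), μ.re < 0) ↔
      (m₂ * kp + b₂ > kd ∧ kd > m₁ * kp + b₁)) := by
  have htr : J.trace = kp * (1 + x₂s) - kd * D * (1 / x₂s + 1) + D / x₂s ^ 2 := by
    rw [hJ, Matrix.trace_fin_two]
    simp
    field_simp
    ring
  have hdet : J.det = kp * D / x₂s ^ 2 - kd + 1 / (x₂s + 1) ^ 2 := by
    rw [hJ, Matrix.det_fin_two]
    simp
    have : 1 + x₂s ≠ 0 := by positivity
    have : x₂s + 1 ≠ 0 := by positivity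
    field_simp
    ring
  refine ⟨htr, hdet, ?_⟩
  simp only [mem_spec_iff]
  rw [quad_hurwitz, and_comm]
  have e1 : J.det = m₂ * kp + b₂ - kd := by
    rw [hdet, hm₂, hb₂, add_comm x₂s 1]
    ring
  have e2 : J.trace = (D * (1 + x₂s) / x₂s) * (m₁ * kp + b₁ - kd) := by
    rw [htr, hm₁, hb₁]
    have : 1 + x₂s ≠ 0 := by positivity
    have : x₂s + x₂s ^ 2 ≠ 0 := by positivity
    field_simp
    ring
  have hc : 0 < D * (1 + x₂s) / x₂s := by positivity
  rw [← smul_eq_mul (D * (1 + x₂s) / x₂s)] at e2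
  rw [e1, e2, smul_neg_iff_of_pos_left hc, sub_pos, sub_neg]
end
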